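/- arXiv:2412.18646 — 8 statements merged into one kernel-verified Lean document; each statement's English description precedes it below -/
import Mathlib

section
/- Let ρ = (ρ_n)_{n≥1} be a state with H(ρ) = liminf_n H(ρ_n)/n < 1. For each n let α^n_1 ≥ α^n_2 ≥ … ≥ α^n_{2^n} be the eigenvalues of ρ_n listed in non-increasing order. Let ε be any real number with H(ρ) < ε < 1. Then there exists δ > 0 such that ∑_{i ≤ ⌈2^{nε}⌉} α^n_i > δ for infinitely many n. -/
open Matrix Filter MeasureTheory
open scoped ComplexOrder

/-- Von Neumann entropy of a Hermitian matrix: the Shannon entropy (base 2) of its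
eigenvalue distribution, with the convention `0 * log₂ 0 = 0` (automatic since
`Real.logb 2 0 = 0`). -/
noncomputable def vnEntropy {ι : Type} [Fintype ι] [DecidableEq ι]
    {A : Matrix ι ι ℂ} (hA : A.IsHermitian) : ℝ :=
  -∑ i, hA.eigenvalues i * Real.logb 2 (hA.eigenvalues i)

/-- A state: a sequence `ρ n` of density matrices on `ℂ^(2^n)` (rows and columns indexed by
length-`n` bitstrings) satisfying the partial-trace coherence condition. -/
structure QState where
  M : (n : ℕ) → Matrix (Fin n → Bool) (Fin n → Bool) ℂ
  posSemidef : ∀ n, (M n).PosSemidef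
  trace_one : ∀ n, (M n).trace = 1
  coherent : ∀ n (σ σ' : Fin n → Bool),
    M n σ σ' = M (n + 1) (Fin.snoc σ false) (Fin.snoc σ' false)
             + M (n + 1) (Fin.snoc σ true) (Fin.snoc σ' true)

/-- The von Neumann entropy of the length-`n` initial segment of a state. -/
noncomputable def QState.entropy (ρ : QState) (n : ℕ) : ℝ :=
  vnEntropy (ρ.posSemidef n).1

theorem sum_eigenvalues_eq_one {ι : Type} [Fintype ι] [DecidableEq ι] {A : Matrix ι ι ℂ}
    (hA : A.IsHermitian) (htr : A.trace = 1) : ∑ i, hA.eigenvalues i = 1 := by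
  have h := hA.trace_eq_sum_eigenvalues
  rw [htr] at h
  apply Complex.ofReal_injective
  simpa using h.symm

theorem neg_sum_mul_logb_le {ι : Type*} [Fintype ι] (p : ι → ℝ) (hp : ∀ i, 0 ≤ p i)
    (hsum : ∑ i, p i = 1) :
    -∑ i, p i * Real.logb 2 (p i) ≤ Real.logb 2 (Fintype.card ι) := by
  have hι : Nonempty ι := by
    by_contra h
    rw [not_nonempty_iff] at h
    simp at hsum
  have hN : (0 : ℝ) < Fintype.card ι := by exact_mod_cast Fintype.card_pos
  have hl : 0 < Real.log 2 := Real.log_pos one_lt_two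
  have key : ∀ i, p i - 1 / Fintype.card ι ≤
      p i * Real.log (p i) + p i * Real.log (Fintype.card ι) := by
    intro i
    rcases (hp i).eq_or_lt with h | h
    · simp [← h]
    · have h1 := Real.one_sub_inv_le_log_of_pos (mul_pos h hN)
      rw [Real.log_mul h.ne' hN.ne'] at h1
      have h2 := mul_le_mul_of_nonneg_left h1 h.le
      have h3 : p i * (1 - (p i * Fintype.card ι)⁻¹) = p i - 1 / Fintype.card ι := by
        field_simp
      linarith
  have h := Finset.sum_le_sum fun i (_ : i ∈ Finset.univ) => key i
  rw [Finset.sum_sub_distrib, Finset.sum_add_distrib, ← Finset.sum_mul, hsum] at h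
  simp only [Finset.sum_const, Finset.card_univ, nsmul_eq_mul, mul_one_div_cancel hN.ne'] at h
  simp only [Real.logb, ← mul_div_assoc, ← Finset.sum_div, ← neg_div]
  gcongr
  linarith

theorem succ_mul_le_sum_of_antitone {N : ℕ} {a : Fin N → ℝ} (ha : Antitone a)
    (h0 : ∀ i, 0 ≤ a i) (i : Fin N) : ((i : ℕ) + 1 : ℝ) * a i ≤ ∑ j, a j := by
  calc ((i : ℕ) + 1 : ℝ) * a i = ∑ _j ∈ Finset.Iic i, a i := by simp
    _ ≤ ∑ j ∈ Finset.Iic i, a j :=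
      Finset.sum_le_sum fun j hj => ha (Finset.mem_Iic.1 hj)
    _ ≤ ∑ j, a j :=
      Finset.sum_le_sum_of_subset_of_nonneg (Finset.subset_univ _) fun j _ _ => h0 j

/-- If the `K ≥ 2 ^ t` largest weights of a probability vector have total mass `S`, then its
entropy is at least `(1 - S) * t`. -/
theorem one_sub_sum_mul_le_neg_sum_mul_logb {N K : ℕ} {a : Fin N → ℝ} (ha : Antitone a)
    (h0 : ∀ i, 0 ≤ a i) (hsum : ∑ i, a i = 1) {t : ℝ} (hK : (2 : ℝ) ^ t ≤ K) :
    (1 - ∑ i ∈ Finset.univ.filter (fun i : Fin N => (i : ℕ) < K), a i) * t ≤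
      -∑ i, a i * Real.logb 2 (a i) := by
  have hle : ∀ i, a i ≤ 1 := fun i =>
    hsum ▸ Finset.single_le_sum (fun j _ => h0 j) (Finset.mem_univ i)
  have hsplit := Finset.sum_filter_add_sum_filter_not Finset.univ
    (fun i : Fin N => (i : ℕ) < K) a
  rw [hsum] at hsplit
  rw [← hsplit, add_sub_cancel_left, Finset.sum_mul, ← Finset.sum_neg_distrib]
  refine (Finset.sum_le_sum (g := fun i => -(a i * Real.logb 2 (a i))) fun i hi => ?_).trans
    (Finset.sum_le_sum_of_subset_of_nonneg (Finset.subset_univ _) fun i _ _ => ?_)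
  · rcases (h0 i).eq_or_lt with h | h
    · simp [← h]
    · have hi' : K ≤ (i : ℕ) := by simpa using hi
      have hi'' : (K : ℝ) ≤ (i : ℕ) := by exact_mod_cast hi'
      have h1 := succ_mul_le_sum_of_antitone ha h0 i
      rw [hsum] at h1
      have hpos : (0 : ℝ) < 2 ^ t := Real.rpow_pos_of_pos two_pos t
      have h2 : a i ≤ (2 : ℝ) ^ (-t) := by
        rw [Real.rpow_neg two_pos.le, ← one_div, le_div_iff₀ hpos]
        nlinarith
      have h3 : Real.logb 2 (a i) ≤ -t :=
        (Real.logb_le_iff_le_rpow one_lt_two h).2 h2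
      nlinarith
  · have := Real.logb_nonpos one_lt_two (h0 i) (hle i)
    nlinarith [h0 i]

namespace QState

theorem entropy_nonneg (ρ : QState) (n : ℕ) : 0 ≤ ρ.entropy n := by
  have h0 := (ρ.posSemidef n).eigenvalues_nonneg
  have hsum := sum_eigenvalues_eq_one (ρ.posSemidef n).1 (ρ.trace_one n)
  rw [entropy, vnEntropy, ← Finset.sum_neg_distrib]
  refine Finset.sum_nonneg fun i _ => ?_
  have hle : (ρ.posSemidef n).1.eigenvalues i ≤ 1 :=
    hsum ▸ Finset.single_le_sum (fun j _ => h0 j) (Finset.mem_univ i)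
  have := Real.logb_nonpos one_lt_two (h0 i) hle
  nlinarith [h0 i]

theorem entropy_le (ρ : QState) (n : ℕ) : ρ.entropy n ≤ n := by
  refine (neg_sum_mul_logb_le _ (ρ.posSemidef n).eigenvalues_nonneg
    (sum_eigenvalues_eq_one (ρ.posSemidef n).1 (ρ.trace_one n))).trans_eq ?_
  simp [Real.logb_pow]

theorem frequently_entropy_div_lt (ρ : QState) {h : ℝ}
    (hh : Filter.liminf (fun n : ℕ => ρ.entropy n / n) Filter.atTop < h) :
    ∃ᶠ n : ℕ in Filter.atTop, ρ.entropy n / n < h := by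
  refine Filter.frequently_lt_of_liminf_lt (Filter.IsBoundedUnder.isCoboundedUnder_ge ?_) hh
  exact Filter.isBoundedUnder_of
    ⟨1, fun n => div_le_one_of_le₀ (ρ.entropy_le n) n.cast_nonneg⟩

end QState

/-- Let `ρ` be a state with `H(ρ) = liminf_n H(ρ_n)/n < 1`, with
`α n` the eigenvalues of `ρ_n` listed in non-increasing order, and let `ε` satisfy
`H(ρ) < ε < 1`.  Then there is a `δ > 0` such that the sum of the `⌈2^(nε)⌉` largest
eigenvalues of `ρ_n` exceeds `δ` for infinitely many `n`. -/
theorem sum_largest_eigenvalues_gt_delta_infinitely_often (ρ : QState)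
    (α : (n : ℕ) → Fin (2 ^ n) → ℝ)
    (hα : ∀ n, Antitone (α n))
    (hperm : ∀ n, ∃ e : (Fin n → Bool) ≃ Fin (2 ^ n),
      ∀ i, α n (e i) = (ρ.posSemidef n).1.eigenvalues i)
    (hH : Filter.liminf (fun n : ℕ => ρ.entropy n / n) Filter.atTop < 1)
    (ε : ℝ)
    (hε1 : Filter.liminf (fun n : ℕ => ρ.entropy n / n) Filter.atTop < ε)
    (hε2 : ε < 1) :
    ∃ δ > 0, ∀ N : ℕ, ∃ n ≥ N,
      δ < ∑ i ∈ Finset.univ.filter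
        (fun i : Fin (2 ^ n) => (i : ℕ) < ⌈(2 : ℝ) ^ ((n : ℝ) * ε)⌉₊), α n i := by
  obtain ⟨h, hh1, hh2⟩ := exists_between hε1
  have hfreq := ρ.frequently_entropy_div_lt hh1
  have hh0 : 0 < h := by
    obtain ⟨n, hn⟩ := hfreq.exists
    exact (div_nonneg (ρ.entropy_nonneg n) n.cast_nonneg).trans_lt hn
  have hε0 : 0 < ε := hh0.trans hh2
  refine ⟨1 - h / ε, sub_pos.2 ((div_lt_one hε0).2 hh2), fun N => ?_⟩
  obtain ⟨n, hnN, hn⟩ := Filter.frequently_atTop.1 hfreq (max N 1)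
  refine ⟨n, (le_max_left _ _).trans hnN, ?_⟩
  have hn0 : (0 : ℝ) < n := by exact_mod_cast (le_max_right N 1).trans hnN
  obtain ⟨e, he⟩ := hperm n
  have hnonneg : ∀ i, 0 ≤ α n i := fun i => by
    rw [← e.apply_symm_apply i, he]
    exact (ρ.posSemidef n).eigenvalues_nonneg _
  have hsum : ∑ i, α n i = 1 := by
    rw [← e.sum_comp]
    simp only [he]
    exact sum_eigenvalues_eq_one (ρ.posSemidef n).1 (ρ.trace_one n)
  have hent : ρ.entropy n = -∑ i, α n i * Real.logb 2 (α n i) := by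
    rw [← e.sum_comp]
    simp only [he]
    rfl
  have key := one_sub_sum_mul_le_neg_sum_mul_logb (hα n) hnonneg hsum
    (Nat.le_ceil ((2 : ℝ) ^ ((n : ℝ) * ε)))
  rw [← hent] at key
  rw [div_lt_iff₀ hn0] at hn
  rw [sub_lt_comm, lt_div_iff₀ hε0]
  refine lt_of_mul_lt_mul_right ?_ hn0.le
  linarith
end

section
/- Let n ≥ 1, let ε ∈ (0,1) and δ ∈ (0, 1/2). Let α_1 ≥ α_2 ≥ … ≥ α_{2^n} ≥ 0 be a non-increasing probability distribution (∑_i α_i = 1) such that ∑_{i ≤ ⌈2^{nε}⌉} α_i ≤ δ. Then the Shannon entropy satisfies -∑_{i=1}^{2^n} α_i·log₂(α_i) > (1 - 2δ)·( log₂(1-δ) - log₂(δ) + n·ε ). -/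
/-- Let `n ≥ 1`, `ε ∈ (0,1)`, `δ ∈ (0,1/2)`, and let
`α 0 ≥ α 1 ≥ … ≥ 0` be a non-increasing probability distribution on `2^n` points such
that the sum of its `⌈2^(nε)⌉` largest values is at most `δ`.  Then its Shannon
entropy exceeds `(1 - 2δ)(log₂(1-δ) - log₂ δ + nε)`. -/
theorem shannon_entropy_lower_bound (n : ℕ) (hn : 1 ≤ n) (ε δ : ℝ)
    (hε : ε ∈ Set.Ioo (0 : ℝ) 1) (hδ : δ ∈ Set.Ioo (0 : ℝ) (1 / 2))
    (α : Fin (2 ^ n) → ℝ) (hα : Antitone α) (hpos : ∀ i, 0 ≤ α i)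
    (hsum : ∑ i, α i = 1)
    (hconc : ∑ i ∈ Finset.univ.filter
      (fun i : Fin (2 ^ n) => (i : ℕ) < ⌈(2 : ℝ) ^ ((n : ℝ) * ε)⌉₊), α i ≤ δ) :
    (1 - 2 * δ) * (Real.logb 2 (1 - δ) - Real.logb 2 δ + n * ε) <
      -∑ i, α i * Real.logb 2 (α i) := by
  obtain ⟨hε0, -⟩ := hε
  obtain ⟨hδ0, hδ1⟩ := hδ
  set K := ⌈(2 : ℝ) ^ ((n : ℝ) * ε)⌉₊ with hK
  have hKle : (2 : ℝ) ^ ((n : ℝ) * ε) ≤ K := Nat.le_ceil _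
  have hP : (0 : ℝ) < (2 : ℝ) ^ ((n : ℝ) * ε) := by positivity
  have hle1 (i) : α i ≤ 1 :=
    hsum ▸ Finset.single_le_sum (fun j _ => hpos j) (Finset.mem_univ i)
  have hhead (i) : 0 ≤ -(α i * Real.logb 2 (α i)) := by
    have := Real.logb_nonpos one_lt_two (hpos i) (hle1 i)
    nlinarith [hpos i]
  have htail (i : Fin (2 ^ n)) (hi : ¬ (i : ℕ) < K) :
      α i * (n * ε - Real.logb 2 δ) ≤ -(α i * Real.logb 2 (α i)) := by
    rcases (hpos i).eq_or_lt with h0 | h0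
    · simp [← h0]
    have hcard : (Finset.univ.filter (fun j : Fin (2 ^ n) => (j : ℕ) < K)).card = K := by
      rw [Fin.card_filter_val_lt]
      exact min_eq_right (by omega)
    have hKα : (K : ℝ) * α i ≤ δ := by
      have := Finset.card_nsmul_le_sum
        (Finset.univ.filter (fun j : Fin (2 ^ n) => (j : ℕ) < K)) α (α i) fun j hj => hα ?_
      · rw [hcard, nsmul_eq_mul] at this
        exact this.trans hconc
      rw [Finset.mem_filter] at hj
      exact Fin.le_def.2 (by omega)
    have hlog := Real.logb_le_logb_of_le one_lt_two (mul_pos hP h0)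
      ((mul_le_mul_of_nonneg_right hKle h0.le).trans hKα)
    rw [Real.logb_mul hP.ne' h0.ne', Real.logb_rpow (by norm_num) (by norm_num)] at hlog
    nlinarith
  have hsplit := Finset.sum_filter_add_sum_filter_not Finset.univ
    (fun i : Fin (2 ^ n) => (i : ℕ) < K) α
  have hsplitH := Finset.sum_filter_add_sum_filter_not Finset.univ
    (fun i : Fin (2 ^ n) => (i : ℕ) < K) (fun i => -(α i * Real.logb 2 (α i)))
  have hH0 := Finset.sum_nonneg
    (s := Finset.univ.filter (fun i : Fin (2 ^ n) => (i : ℕ) < K)) fun i _ => hhead i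
  have hH1 := Finset.sum_le_sum
    (s := Finset.univ.filter (fun i : Fin (2 ^ n) => ¬ (i : ℕ) < K))
    fun i hi => htail i (Finset.mem_filter.1 hi).2
  rw [← Finset.sum_mul] at hH1
  rw [Finset.sum_neg_distrib (s := Finset.univ)] at hsplitH
  have hlogδ : Real.logb 2 δ < 0 := Real.logb_neg one_lt_two hδ0 (by linarith)
  have hlogδ' : Real.logb 2 (1 - δ) < 0 :=
    Real.logb_neg one_lt_two (by linarith) (by linarith)
  have hL : 0 < n * ε - Real.logb 2 δ := by
    have : 0 ≤ n * ε := by positivity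
    linarith
  have hmass : 1 - δ ≤ ∑ i ∈ Finset.univ.filter
      (fun i : Fin (2 ^ n) => ¬ (i : ℕ) < K), α i := by linarith
  have hfinal := mul_le_mul_of_nonneg_right hmass hL.le
  nlinarith [mul_pos hδ0 hL, mul_pos (by linarith : 0 < 1 - 2 * δ) (neg_pos.2 hlogδ')]
end

section
/- There exists a state ρ = (ρ_n)_{n≥1} such that lim_{n→∞} H(ρ_n)/n = 1, and yet there exist a strictly increasing sequence (n_m)_{m≥1} of natural numbers and Hermitian projections G^m on ℂ^{2^{n_m}} with 2^{-n_m}·Tr(G^m) = 2^{-m} and Tr(ρ_{n_m}·G^m) = 1 for all m ≥ 1. (Such a state has maximal entropy rate but fails a quantum Schnorr-type test at order 1; one can take n_m = m + ∑_{i=1}^m i and ρ_{n_m} = ⨂_{i=1}^{m} (|0⟩⟨0| ⊗ 2^{-i} I_i).) -/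
open Matrix Filter MeasureTheory
open scoped ComplexOrder

/-- Weight of the bit `b` at position `i`: deterministic at perfect squares, uniform elsewhere. -/
noncomputable def bitWeight (i : ℕ) (b : Bool) : ℂ :=
  if IsSquare i then (if b then 0 else 1) else 1 / 2

/-- Indicator that the bit `b` is admissible at position `i`. -/
noncomputable def bitSupport (i : ℕ) (b : Bool) : ℂ :=
  if IsSquare i then (if b then 0 else 1) else 1

lemma sum_bitWeight (i : ℕ) : ∑ b, bitWeight i b = 1 := by
  by_cases h : IsSquare i <;> simp [bitWeight, h]

lemma sum_bitSupport (i : ℕ) : ∑ b, bitSupport i b = if ¬ IsSquare i then 2 else 1 := by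
  by_cases h : IsSquare i <;> simp [bitSupport, h]

lemma bitWeight_nonneg (i : ℕ) (b : Bool) : 0 ≤ bitWeight i b := by
  by_cases h : IsSquare i <;> cases b <;> simp [bitWeight, h]

lemma bitWeight_mul_self (i : ℕ) (b : Bool) :
    bitWeight i b * bitWeight i b = (if ¬ IsSquare i then 1 / 2 else 1) * bitWeight i b := by
  by_cases h : IsSquare i <;> cases b <;> simp [bitWeight, h]

lemma bitSupport_mul_self (i : ℕ) (b : Bool) :
    bitSupport i b * bitSupport i b = bitSupport i b := by
  by_cases h : IsSquare i <;> cases b <;> simp [bitSupport, h]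

lemma bitWeight_mul_bitSupport (i : ℕ) (b : Bool) :
    bitWeight i b * bitSupport i b = bitWeight i b := by
  by_cases h : IsSquare i <;> cases b <;> simp [bitWeight, bitSupport, h]

lemma star_bitSupport (i : ℕ) (b : Bool) : star (bitSupport i b) = bitSupport i b := by
  by_cases h : IsSquare i <;> cases b <;> simp [bitSupport, h]

lemma prod_fin_ite_eq_pow_count (p : ℕ → Prop) [DecidablePred p] (x : ℂ) (n : ℕ) :
    ∏ i : Fin n, (if p i then x else 1) = x ^ Nat.count p n := by
  induction n with
  | zero => simp
  | succ n ih =>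
    rw [Fin.prod_univ_castSucc, Nat.count_succ]
    by_cases h : p n <;> simp [ih, h, pow_succ]

lemma count_add_count_not (p : ℕ → Prop) [DecidablePred p] (n : ℕ) :
    Nat.count p n + Nat.count (fun i => ¬ p i) n = n := by
  induction n with
  | zero => simp
  | succ n ih =>
    rw [Nat.count_succ, Nat.count_succ]
    by_cases h : p n <;> simp [h] <;> omega

lemma count_isSquare_sq (m : ℕ) : Nat.count IsSquare (m ^ 2) = m := by
  have h : (Finset.range (m ^ 2)).filter IsSquare = (Finset.range m).image (· ^ 2) := by
    ext k
    simp only [Finset.mem_filter, Finset.mem_range, Finset.mem_image]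
    constructor
    · rintro ⟨hk, r, rfl⟩
      exact ⟨r, by nlinarith, by ring⟩
    · rintro ⟨r, hr, rfl⟩
      exact ⟨Nat.pow_lt_pow_left hr two_ne_zero, r, by ring⟩
  rw [Nat.count_eq_card_filter_range, h,
    Finset.card_image_of_injective _ (Nat.pow_left_injective two_ne_zero), Finset.card_range]

lemma count_isSquare_le (n : ℕ) : Nat.count IsSquare n ≤ Nat.sqrt n + 1 := by
  conv_rhs => rw [← count_isSquare_sq (Nat.sqrt n + 1)]
  exact Nat.count_monotone _ (Nat.lt_succ_sqrt' n).le

lemma tendsto_count_not_isSquare_div :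
    Tendsto (fun n : ℕ => (Nat.count (fun i => ¬ IsSquare i) n : ℝ) / n) atTop (nhds 1) := by
  have hlim : Tendsto (fun n : ℕ => 1 - (1 / √(n : ℝ) + 1 / (n : ℝ))) atTop (nhds 1) := by
    have h₁ : Tendsto (fun n : ℕ => 1 / √(n : ℝ)) atTop (nhds 0) := by
      simpa only [one_div, Function.comp_def] using tendsto_inv_atTop_zero.comp
        (Real.tendsto_sqrt_atTop.comp tendsto_natCast_atTop_atTop)
    simpa using (tendsto_const_nhds (x := (1 : ℝ))).sub
      (h₁.add tendsto_one_div_atTop_nhds_zero_nat)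
  refine tendsto_of_tendsto_of_tendsto_of_le_of_le' hlim tendsto_const_nhds ?_ ?_
  · filter_upwards [eventually_gt_atTop 0] with n hn
    have hn' : (0 : ℝ) < n := by exact_mod_cast hn
    have hs : (0 : ℝ) < √(n : ℝ) := Real.sqrt_pos.2 hn'
    have hadd : (Nat.count IsSquare n : ℝ) + Nat.count (fun i => ¬ IsSquare i) n = n := by
      exact_mod_cast count_add_count_not IsSquare n
    have hle : (Nat.count IsSquare n : ℝ) ≤ √(n : ℝ) + 1 := by
      have h : (Nat.count IsSquare n : ℝ) ≤ Nat.sqrt n + 1 := by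
        exact_mod_cast count_isSquare_le n
      linarith [Real.nat_sqrt_le_real_sqrt (a := n)]
    rw [le_div_iff₀ hn']
    have h₁ : 1 / √(n : ℝ) * n = √(n : ℝ) := by
      rw [div_mul_eq_mul_div, one_mul, Real.div_sqrt]
    have h₂ : 1 / (n : ℝ) * n = 1 := by field_simp
    rw [sub_mul, add_mul, h₁, h₂]
    linarith
  · filter_upwards with n
    exact div_le_one_of_le₀ (Nat.cast_le.2 (Nat.count_le _)) (Nat.cast_nonneg n)

/-- A unit-trace Hermitian matrix proportional to a projection, with factor `2⁻ᵈ`, has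
von Neumann entropy `d`. -/
lemma vnEntropy_eq_of_mul_self {ι : Type} [Fintype ι] [DecidableEq ι] {A : Matrix ι ι ℂ}
    (hA : A.IsHermitian) (htr : A.trace = 1) (d : ℕ) (hsq : A * A = ((1 / 2 : ℂ) ^ d) • A) :
    vnEntropy hA = d := by
  have hev (i : ι) : hA.eigenvalues i = 0 ∨ hA.eigenvalues i = (1 / 2 : ℝ) ^ d := by
    have hv := hA.mulVec_eigenvectorBasis i
    set v := (hA.eigenvectorBasis i).ofLp with hvdef
    have hv0 : v ≠ 0 := by
      intro h
      apply hA.eigenvectorBasis.orthonormal.ne_zero i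
      ext j
      exact congrFun h j
    have h₁ : (A * A) *ᵥ v = (hA.eigenvalues i * hA.eigenvalues i) • v := by
      rw [← Matrix.mulVec_mulVec, hv, Matrix.mulVec_smul, hv, smul_smul]
    have h₂ : (A * A) *ᵥ v = ((1 / 2 : ℝ) ^ d * hA.eigenvalues i) • v := by
      rw [hsq, Matrix.smul_mulVec, hv]
      ext j
      simp [mul_assoc]
    have h₃ := smul_left_injective ℝ hv0 (h₁.symm.trans h₂)
    rcases eq_or_ne (hA.eigenvalues i) 0 with h | h
    · exact Or.inl h
    · exact Or.inr (mul_right_cancel₀ h h₃)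
  have hsum : ∑ i, hA.eigenvalues i = 1 := by
    have h := congrArg Complex.re hA.trace_eq_sum_eigenvalues
    rw [htr] at h
    simpa using h.symm
  have hlog : Real.logb 2 ((1 / 2 : ℝ) ^ d) = -d := by
    rw [Real.logb_pow, one_div, Real.logb_inv, Real.logb_self_eq_one one_lt_two]
    ring
  have hterm (i : ι) :
      hA.eigenvalues i * Real.logb 2 (hA.eigenvalues i) = hA.eigenvalues i * -d := by
    rcases hev i with h | h
    · simp [h]
    · rw [h, hlog]
  rw [vnEntropy, Finset.sum_congr rfl fun i _ => hterm i, ← Finset.sum_mul, hsum]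
  ring

/-- The diagonal product state with bit weights `bitWeight`. -/
noncomputable def squareState : QState where
  M n := Matrix.diagonal fun σ => ∏ i : Fin n, bitWeight i (σ i)
  posSemidef n := Matrix.PosSemidef.diagonal fun σ =>
    Finset.prod_nonneg fun i _ => bitWeight_nonneg i (σ i)
  trace_one n := by
    rw [Matrix.trace_diagonal, ← Fintype.prod_sum]
    simp only [sum_bitWeight, Finset.prod_const_one]
  coherent n σ σ' := by
    have h (b : Bool) : (Fin.snoc σ b : Fin (n + 1) → Bool) = Fin.snoc σ' b ↔ σ = σ' := by
      rw [Fin.snoc_inj]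
      simp
    rw [Matrix.diagonal_apply, Matrix.diagonal_apply, Matrix.diagonal_apply]
    simp only [h]
    split_ifs
    · have hs := sum_bitWeight n
      rw [Fintype.sum_bool] at hs
      simp only [Fin.prod_univ_castSucc, Fin.snoc_castSucc, Fin.snoc_last, Fin.val_castSucc,
        Fin.val_last]
      rw [← mul_add, add_comm, hs, mul_one]
    · simp

lemma entropy_squareState (n : ℕ) :
    squareState.entropy n = Nat.count (fun i => ¬ IsSquare i) n := by
  refine vnEntropy_eq_of_mul_self _ (squareState.trace_one n) _ ?_
  simp only [squareState, Matrix.diagonal_mul_diagonal, ← Matrix.diagonal_smul,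
    ← Finset.prod_mul_distrib, bitWeight_mul_self]
  congr 1
  ext σ
  rw [Finset.prod_mul_distrib, prod_fin_ite_eq_pow_count (fun i => ¬ IsSquare i)]
  rfl

/-- The projection onto the span of the bitstrings admissible for `squareState`. -/
noncomputable def supportProj (n : ℕ) : Matrix (Fin n → Bool) (Fin n → Bool) ℂ :=
  Matrix.diagonal fun σ => ∏ i : Fin n, bitSupport i (σ i)

lemma trace_supportProj (n : ℕ) :
    (supportProj n).trace = 2 ^ Nat.count (fun i => ¬ IsSquare i) n := by
  rw [supportProj, Matrix.trace_diagonal, ← Fintype.prod_sum (fun (i : Fin n) b => bitSupport i b)]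
  simp only [sum_bitSupport]
  exact prod_fin_ite_eq_pow_count (fun i => ¬ IsSquare i) 2 n

/-- There is a state with maximal entropy rate (`lim_n H(ρ_n)/n = 1`)
which nevertheless fails a quantum Schnorr-type test at order 1: there are a strictly
increasing sequence `n_m` and Hermitian projections `G^m` on `ℂ^(2^(n_m))` with
`2^(-n_m)·Tr(G^m) = 2^(-m)` and `Tr(ρ_(n_m)·G^m) = 1` for all `m ≥ 1`. -/
theorem exists_max_entropy_rate_not_schnorr_random :
    ∃ ρ : QState,
      Filter.Tendsto (fun n : ℕ => ρ.entropy n / n) Filter.atTop (nhds 1) ∧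
      ∃ nm : ℕ → ℕ, StrictMono nm ∧
        ∃ G : (m : ℕ) → Matrix (Fin (nm m) → Bool) (Fin (nm m) → Bool) ℂ,
          ∀ m, 1 ≤ m →
            (G m).IsHermitian ∧ G m * G m = G m ∧
            (2 : ℝ) ^ (-(nm m : ℤ)) * ((G m).trace).re = (2 : ℝ) ^ (-(m : ℤ)) ∧
            ((ρ.M (nm m) * G m).trace).re = 1 := by
  refine ⟨squareState, ?_, fun m => m ^ 2, Nat.pow_left_strictMono two_ne_zero,
    fun m => supportProj (m ^ 2), fun m _ => ⟨?_, ?_, ?_, ?_⟩⟩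
  · simpa only [entropy_squareState] using tendsto_count_not_isSquare_div
  · refine Matrix.isHermitian_diagonal_of_self_adjoint _ ?_
    ext σ
    simp only [Pi.star_apply, star_prod, star_bitSupport]
  · simp only [supportProj, Matrix.diagonal_mul_diagonal, ← Finset.prod_mul_distrib,
      bitSupport_mul_self]
  · rw [trace_supportProj]
    have hadd := count_add_count_not IsSquare (m ^ 2)
    rw [count_isSquare_sq] at hadd
    generalize Nat.count (fun i => ¬ IsSquare i) (m ^ 2) = d at hadd ⊢
    have hre : ((2 : ℂ) ^ d).re = (2 : ℝ) ^ (d : ℤ) := by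
      rw [zpow_natCast]
      exact_mod_cast Complex.ofReal_re ((2 : ℝ) ^ d)
    rw [hre, ← zpow_add₀ two_ne_zero]
    congr 1
    dsimp only
    omega
  · have h : squareState.M (m ^ 2) * supportProj (m ^ 2) = squareState.M (m ^ 2) := by
      simp only [squareState, supportProj, Matrix.diagonal_mul_diagonal,
        ← Finset.prod_mul_distrib, bitWeight_mul_bitSupport]
    rw [h, squareState.trace_one, Complex.one_re]
end

section
/- Let 1 ≤ m ≤ n and let α_1 ≥ α_2 ≥ … ≥ α_{2^n} ≥ 0 be a non-increasing probability distribution (∑_i α_i = 1). Let S = ∑_{i ≤ 2^{n-m}} α_i be the sum of the largest 2^{n-m} values. Then the Shannon entropy satisfies -∑_{i=1}^{2^n} α_i·log₂(α_i) ≤ 1 - m·S + n. -/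
theorem neg_mul_log_le_mul_log_add_sub {a q : ℝ} (ha : 0 ≤ a) (hq : 0 < q) :
    -(a * Real.log a) ≤ -(a * Real.log q) + (q - a) := by
  rcases ha.eq_or_lt with rfl | ha
  · simpa using hq.le
  · have h := mul_le_mul_of_nonneg_left (Real.log_le_sub_one_of_pos (div_pos hq ha)) ha.le
    rw [Real.log_div hq.ne' ha.ne', mul_sub, mul_sub, mul_div_cancel₀ q ha.ne'] at h
    linarith

/-- The entropy of a distribution is at most the average length of a code whose word lengths
satisfy Kraft's inequality. -/
theorem entropy_le_sum_mul_length {ι : Type*} [Fintype ι] (a : ι → ℝ) (k : ι → ℕ)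
    (ha : ∀ i, 0 ≤ a i) (hsum : ∑ i, a i = 1) (hk : ∑ i, ((2 : ℝ) ^ k i)⁻¹ ≤ 1) :
    -∑ i, a i * Real.logb 2 (a i) ≤ ∑ i, a i * k i := by
  have hlog : 0 < Real.log 2 := Real.log_pos one_lt_two
  have key : ∑ i, -(a i * Real.log (a i)) ≤
      ∑ i, (a i * k i * Real.log 2 + (((2 : ℝ) ^ k i)⁻¹ - a i)) := by
    refine Finset.sum_le_sum fun i _ => ?_
    have h := neg_mul_log_le_mul_log_add_sub (ha i) (q := ((2 : ℝ) ^ k i)⁻¹) (by positivity)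
    rw [Real.log_inv, Real.log_pow] at h
    linarith
  rw [Finset.sum_add_distrib, Finset.sum_sub_distrib, hsum, ← Finset.sum_mul,
    Finset.sum_neg_distrib] at key
  simp only [Real.logb, ← mul_div_assoc]
  rw [← Finset.sum_div, ← neg_div, div_le_iff₀ hlog]
  linarith

/-- Let `1 ≤ m ≤ n` and let `α 0 ≥ α 1 ≥ … ≥ 0` be a non-increasing
probability distribution on `2^n` points, and let `S` be the sum of its `2^(n-m)`
largest values.  Then its Shannon entropy is at most `1 - m·S + n`. -/
theorem shannon_entropy_upper_bound (n m : ℕ) (hm : 1 ≤ m) (hmn : m ≤ n)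
    (α : Fin (2 ^ n) → ℝ) (hα : Antitone α) (hpos : ∀ i, 0 ≤ α i)
    (hsum : ∑ i, α i = 1) :
    -∑ i, α i * Real.logb 2 (α i) ≤
      1 - (m : ℝ) * (∑ i ∈ Finset.univ.filter
        (fun i : Fin (2 ^ n) => (i : ℕ) < 2 ^ (n - m)), α i) + n := by
  classical
  set s := Finset.univ.filter (fun i : Fin (2 ^ n) => (i : ℕ) < 2 ^ (n - m)) with hs
  have hcard : s.card = 2 ^ (n - m) := by
    rw [hs, Fin.card_filter_val_lt]
    exact min_eq_right (Nat.pow_le_pow_right two_pos (n.sub_le m))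
  refine (entropy_le_sum_mul_length α
    (fun i => if i ∈ s then n - m + 1 else n + 1) hpos hsum ?_).trans_eq ?_
  · calc ∑ i, ((2 : ℝ) ^ (if i ∈ s then n - m + 1 else n + 1))⁻¹
        ≤ ∑ i, ((if i ∈ s then ((2 : ℝ) ^ (n - m + 1))⁻¹ else 0) + ((2 : ℝ) ^ (n + 1))⁻¹) := by
          refine Finset.sum_le_sum fun i _ => ?_
          split_ifs
          · exact le_add_of_nonneg_right (by positivity)
          · simp
      _ = 1 := by
          rw [Finset.sum_add_distrib, Finset.sum_ite_mem, Finset.univ_inter, Finset.sum_const,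
            Finset.sum_const, hcard, Finset.card_univ, Fintype.card_fin]
          simp only [nsmul_eq_mul, Nat.cast_pow, Nat.cast_ofNat, pow_succ]
          field_simp
          norm_num
  · have h : ∀ i, α i * ((if i ∈ s then n - m + 1 else n + 1 : ℕ) : ℝ) =
        α i * (n + 1) - m * (if i ∈ s then α i else 0) := by
      intro i
      split_ifs
      · push_cast [Nat.cast_sub hmn]
        ring
      · push_cast
        ring
    rw [Finset.sum_congr rfl fun i _ => h i, Finset.sum_sub_distrib, ← Finset.sum_mul,
      ← Finset.mul_sum, hsum, Finset.sum_ite_mem, Finset.univ_inter]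
    ring
end

section
/- Let ρ = (ρ_n)_{n≥1} be a state. Suppose there exists a natural number c such that H(ρ_n) > n - c for infinitely many n. Then ρ is strong quantum random: for every sequence (T^m)_{m≥1} of Hermitian projections, with T^m on ℂ^{2^{N_m}}, satisfying lim_{m→∞} 2^{-N_m}·Tr(T^m) = 0, one has inf_m Tr(ρ_{N_m}·T^m) = 0. -/
open Matrix Filter MeasureTheory
open scoped ComplexOrder

section DensityMatrix

variable {ι : Type} [Fintype ι]

/-- The diagonal entries of a Hermitian projection lie in `[0, 1]`. -/
lemma diag_re_mem_Icc_of_projection {P : Matrix ι ι ℂ} (hP : P.IsHermitian)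
    (hPP : P * P = P) (i : ι) : 0 ≤ (P i i).re ∧ (P i i).re ≤ 1 := by
  have key : (P i i).re = ∑ j, Complex.normSq (P i j) := by
    conv_lhs => rw [← hPP, Matrix.mul_apply, Complex.re_sum]
    refine Finset.sum_congr rfl fun j _ => ?_
    rw [← hP.apply j i, Complex.star_def, Complex.mul_conj, Complex.ofReal_re]
  have h0 : 0 ≤ (P i i).re := key ▸ Finset.sum_nonneg fun j _ => Complex.normSq_nonneg _
  have h1 : Complex.normSq (P i i) ≤ (P i i).re := by
    rw [key]
    exact Finset.single_le_sum (f := fun j => Complex.normSq (P i j))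
      (fun j _ => Complex.normSq_nonneg _) (Finset.mem_univ i)
  rw [Complex.normSq_apply] at h1
  refine ⟨h0, ?_⟩
  nlinarith [mul_self_nonneg (P i i).im]

variable [DecidableEq ι]

/-- In an eigenbasis of `A`, a Hermitian projection `P` has diagonal entries `t i ∈ [0, 1]`
which sum to `Tr P` and whose average against the eigenvalues of `A` is `Tr (A P)`. -/
lemma exists_diag_of_projection {A P : Matrix ι ι ℂ} (hA : A.IsHermitian)
    (hP : P.IsHermitian) (hPP : P * P = P) :
    ∃ t : ι → ℝ, (∀ i, 0 ≤ t i ∧ t i ≤ 1) ∧ ∑ i, t i = P.trace.re ∧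
      ∑ i, hA.eigenvalues i * t i = ((A * P).trace).re := by
  set U : Matrix ι ι ℂ := (hA.eigenvectorUnitary : Matrix ι ι ℂ) with hU
  have hUU : U * star U = 1 := Unitary.mul_star_self_of_mem hA.eigenvectorUnitary.2
  set B := star U * P * U with hB
  have hBh : B.IsHermitian := Matrix.isHermitian_conjTranspose_mul_mul U hP
  have hBB : B * B = B := by
    calc B * B = star U * P * (U * star U) * P * U := by simp only [hB, mul_assoc]
      _ = star U * (P * P) * U := by rw [hUU]; simp only [mul_assoc, one_mul]
      _ = B := by rw [hPP]
  refine ⟨fun i => (B i i).re, fun i => diag_re_mem_Icc_of_projection hBh hBB i, ?_, ?_⟩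
  · have : B.trace = P.trace := by
      rw [hB, Matrix.trace_mul_comm, ← mul_assoc, hUU, one_mul]
    rw [← this, Matrix.trace, Complex.re_sum]
    rfl
  · have hAP : (A * P).trace =
        (Matrix.diagonal (RCLike.ofReal ∘ hA.eigenvalues) * B).trace := by
      conv_lhs => rw [hA.spectral_theorem, Unitary.conjStarAlgAut_apply]
      rw [mul_assoc, mul_assoc, Matrix.trace_mul_comm, hB]
      simp only [mul_assoc, hU]
    rw [hAP, Matrix.trace, Complex.re_sum]
    refine Finset.sum_congr rfl fun i _ => ?_
    simp [Matrix.diagonal_mul]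

lemma trace_mul_projection_re_nonneg {A P : Matrix ι ι ℂ} (hA : A.PosSemidef)
    (hP : P.IsHermitian) (hPP : P * P = P) : 0 ≤ ((A * P).trace).re := by
  obtain ⟨t, ht, -, hAt⟩ := exists_diag_of_projection hA.1 hP hPP
  rw [← hAt]
  exact Finset.sum_nonneg fun i _ => mul_nonneg (hA.eigenvalues_nonneg i) (ht i).1

/-- Tangent-line form of the Gibbs inequality for one term. -/
lemma neg_mul_log_le_of_exp {x : ℝ} (hx : 0 ≤ x) (y : ℝ) :
    -(x * Real.log x) ≤ -(x * y) + Real.exp y - x := by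
  rcases hx.eq_or_lt with rfl | hx
  · simpa using (Real.exp_pos y).le
  · have h := Real.add_one_le_exp (y - Real.log x)
    rw [Real.exp_sub, Real.exp_log hx, le_div_iff₀ hx] at h
    linarith

lemma exp_mul_le_one_add {t : ℝ} (h0 : 0 ≤ t) (h1 : t ≤ 1) (L : ℝ) :
    Real.exp (t * L) ≤ 1 + t * Real.exp L := by
  have h := convexOn_exp.2 (Set.mem_univ 0) (Set.mem_univ L) (sub_nonneg.2 h1) h0 (by ring)
  simp only [smul_eq_mul, mul_zero, zero_add, Real.exp_zero, mul_one] at h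
  linarith

/-- A projection of normalized rank at most `exp (-L)` carrying mass `p` of a density matrix
forces the entropy down by about `p * L`. -/
lemma vnEntropy_mul_log_two_le {A P : Matrix ι ι ℂ} (hA : A.PosSemidef) (htr : A.trace = 1)
    (hP : P.IsHermitian) (hPP : P * P = P) {L : ℝ}
    (hL : Real.exp L * P.trace.re ≤ Fintype.card ι) :
    vnEntropy hA.1 * Real.log 2 ≤
      Real.log 2 + Real.log (Fintype.card ι) - ((A * P).trace).re * L := by
  obtain ⟨t, ht, hPt, hAt⟩ := exists_diag_of_projection hA.1 hP hPP
  have hsum : ∑ i, hA.1.eigenvalues i = 1 := by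
    have h := hA.1.trace_eq_sum_eigenvalues
    rw [htr] at h
    exact Complex.ofReal_injective (by simpa using h.symm)
  have hι : Nonempty ι := by
    by_contra h
    rw [not_nonempty_iff] at h
    simp at hsum
  have hcard : (0 : ℝ) < Fintype.card ι := by exact_mod_cast Fintype.card_pos
  set C := Real.log 2 + Real.log (Fintype.card ι) with hC
  have hexpC : Real.exp C = 2 * Fintype.card ι := by
    rw [hC, Real.exp_add, Real.exp_log two_pos, Real.exp_log hcard]
  have hent : vnEntropy hA.1 * Real.log 2 =
      ∑ i, -(hA.1.eigenvalues i * Real.log (hA.1.eigenvalues i)) := by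
    rw [vnEntropy, neg_mul, Finset.sum_mul, ← Finset.sum_neg_distrib]
    refine Finset.sum_congr rfl fun i _ => ?_
    rw [mul_assoc, Real.logb, div_mul_cancel₀ _ (Real.log_pos one_lt_two).ne']
  have hexp : ∑ i, Real.exp (t i * L - C) ≤ 1 := by
    simp only [Real.exp_sub, ← Finset.sum_div, hexpC]
    rw [div_le_one (by positivity)]
    calc ∑ i, Real.exp (t i * L) ≤ ∑ i, (1 + t i * Real.exp L) :=
          Finset.sum_le_sum fun i _ => exp_mul_le_one_add (ht i).1 (ht i).2 L
      _ = Fintype.card ι + Real.exp L * P.trace.re := by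
          rw [Finset.sum_add_distrib, ← Finset.sum_mul, hPt]
          simp [mul_comm]
      _ ≤ 2 * Fintype.card ι := by linarith
  calc vnEntropy hA.1 * Real.log 2
      ≤ ∑ i, (-(hA.1.eigenvalues i * (t i * L - C)) + Real.exp (t i * L - C)
          - hA.1.eigenvalues i) := by
        rw [hent]
        exact Finset.sum_le_sum fun i _ => neg_mul_log_le_of_exp (hA.eigenvalues_nonneg i) _
    _ = C * ∑ i, hA.1.eigenvalues i - (∑ i, hA.1.eigenvalues i * t i) * L
          + ∑ i, Real.exp (t i * L - C) - ∑ i, hA.1.eigenvalues i := by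
        rw [Finset.mul_sum, Finset.sum_mul, ← Finset.sum_sub_distrib,
          ← Finset.sum_add_distrib, ← Finset.sum_sub_distrib]
        exact Finset.sum_congr rfl fun i _ => by ring
    _ ≤ C - ((A * P).trace).re * L := by
        rw [hsum, hAt]
        linarith

end DensityMatrix

namespace QState

/-- The projection `1 ⊗ P` on `n + 1` qubits, the identity acting on the last one. -/
lemma exists_lift_succ (ρ : QState) {n : ℕ} {P : Matrix (Fin n → Bool) (Fin n → Bool) ℂ}
    (hP : P.IsHermitian) (hPP : P * P = P) :
    ∃ Q : Matrix (Fin (n + 1) → Bool) (Fin (n + 1) → Bool) ℂ, Q.IsHermitian ∧ Q * Q = Q ∧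
      Q.trace = 2 * P.trace ∧ (ρ.M (n + 1) * Q).trace = (ρ.M n * P).trace := by
  let e : Bool × (Fin n → Bool) ≃ (Fin (n + 1) → Bool) := Fin.snocEquiv fun _ => Bool
  let K : Matrix (Bool × (Fin n → Bool)) (Bool × (Fin n → Bool)) ℂ :=
    Matrix.kroneckerMap (· * ·) (1 : Matrix Bool Bool ℂ) P
  have htrace (R : Matrix (Bool × (Fin n → Bool)) (Bool × (Fin n → Bool)) ℂ) :
      (R.submatrix e.symm e.symm).trace = R.trace := by
    simp only [Matrix.trace, Matrix.diag, Matrix.submatrix_apply]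
    exact e.symm.sum_comp fun x => R x x
  refine ⟨K.submatrix e.symm e.symm, ?_, ?_, ?_, ?_⟩
  · refine Matrix.IsHermitian.submatrix ?_ _
    rw [Matrix.IsHermitian, Matrix.conjTranspose_kronecker, hP.eq, Matrix.conjTranspose_one]
  · rw [Matrix.submatrix_mul_equiv, ← Matrix.mul_kronecker_mul, hPP, one_mul]
  · rw [htrace, Matrix.trace_kronecker]
    simp
  · have h : ρ.M (n + 1) = ((ρ.M (n + 1)).submatrix e e).submatrix e.symm e.symm := by
      simp
    rw [h, Matrix.submatrix_mul_equiv, htrace]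
    have he (b : Bool) (σ : Fin n → Bool) :
        e (b, σ) = (Fin.snoc σ b : Fin (n + 1) → Bool) := rfl
    simp only [Matrix.trace, Matrix.diag, Matrix.mul_apply, Fintype.sum_prod_type,
      Fintype.sum_bool, K, Matrix.kroneckerMap_apply, Matrix.submatrix_apply, Matrix.one_apply,
      he, ρ.coherent n, add_mul, Finset.sum_add_distrib]
    simp [add_comm]

lemma exists_lift (ρ : QState) {n : ℕ} {P : Matrix (Fin n → Bool) (Fin n → Bool) ℂ}
    (hP : P.IsHermitian) (hPP : P * P = P) (k : ℕ) (hk : n ≤ k) :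
    ∃ Q : Matrix (Fin k → Bool) (Fin k → Bool) ℂ, Q.IsHermitian ∧ Q * Q = Q ∧
      Q.trace = 2 ^ (k - n) * P.trace ∧ (ρ.M k * Q).trace = (ρ.M n * P).trace := by
  induction k, hk using Nat.le_induction with
  | base => exact ⟨P, hP, hPP, by simp, rfl⟩
  | succ k hk ih =>
    obtain ⟨Q, hQ, hQQ, htr, hρ⟩ := ih
    obtain ⟨R, hR, hRR, htr', hρ'⟩ := ρ.exists_lift_succ hQ hQQ
    refine ⟨R, hR, hRR, ?_, hρ'.trans hρ⟩
    rw [htr', htr, Nat.succ_sub hk, pow_succ]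
    ring

lemma entropy_mul_log_two_le (ρ : QState) {N n : ℕ} (hn : N ≤ n)
    {P : Matrix (Fin N → Bool) (Fin N → Bool) ℂ} (hP : P.IsHermitian) (hPP : P * P = P) {L : ℝ}
    (hL : (2 : ℝ) ^ (-(N : ℤ)) * P.trace.re ≤ Real.exp (-L)) :
    ρ.entropy n * Real.log 2 ≤ (n + 1) * Real.log 2 - ((ρ.M N * P).trace).re * L := by
  obtain ⟨Q, hQ, hQQ, htr, hρ⟩ := ρ.exists_lift hP hPP n hn
  have hre : Q.trace.re = 2 ^ (n - N) * P.trace.re := by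
    rw [htr, show ((2 : ℂ) ^ (n - N)) = (((2 : ℝ) ^ (n - N) : ℝ) : ℂ) by push_cast; rfl,
      Complex.re_ofReal_mul]
  have hcard : (Fintype.card (Fin n → Bool) : ℝ) = 2 ^ n := by simp
  have hQL : Real.exp L * Q.trace.re ≤ Fintype.card (Fin n → Bool) := by
    have hpow : (2 : ℝ) ^ (n - N) = 2 ^ n * 2 ^ (-(N : ℤ)) := by
      rw [pow_sub₀ _ two_ne_zero hn, _root_.zpow_neg, zpow_natCast]
    calc Real.exp L * Q.trace.re
        = 2 ^ n * Real.exp L * ((2 : ℝ) ^ (-(N : ℤ)) * P.trace.re) := by rw [hre, hpow]; ring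
      _ ≤ 2 ^ n * Real.exp L * Real.exp (-L) := by gcongr
      _ = Fintype.card (Fin n → Bool) := by
        rw [mul_assoc, ← Real.exp_add, add_neg_cancel, Real.exp_zero, mul_one, hcard]
  have h := vnEntropy_mul_log_two_le (ρ.posSemidef n) (ρ.trace_one n) hQ hQQ hQL
  rw [hρ, hcard, Real.log_pow] at h
  rw [entropy]
  linarith

end QState

/-- If there is a natural number `c` with `H(ρ_n) > n - c` for
infinitely many `n`, then `ρ` is strong quantum random: it satisfies every quantum null
condition, i.e. for every sequence of Hermitian projections `T^m` on `ℂ^(2^(N_m))` with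
`lim_m 2^(-N_m)·Tr(T^m) = 0` one has `inf_m Tr(ρ_(N_m)·T^m) = 0`. -/
theorem high_entropy_implies_strong_quantum_random (ρ : QState)
    (hc : ∃ c : ℕ, ∀ N : ℕ, ∃ n ≥ N, (n : ℝ) - c < ρ.entropy n) :
    ∀ (Nm : ℕ → ℕ) (T : (m : ℕ) → Matrix (Fin (Nm m) → Bool) (Fin (Nm m) → Bool) ℂ),
      (∀ m, (T m).IsHermitian ∧ T m * T m = T m) →
      Filter.Tendsto (fun m => (2 : ℝ) ^ (-(Nm m : ℤ)) * ((T m).trace).re)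
        Filter.atTop (nhds 0) →
      ⨅ m, ((ρ.M (Nm m) * T m).trace).re = 0 := by
  intro Nm T hT hlim
  obtain ⟨c, hc⟩ := hc
  have hnonneg (m : ℕ) : 0 ≤ ((ρ.M (Nm m) * T m).trace).re :=
    trace_mul_projection_re_nonneg (ρ.posSemidef _) (hT m).1 (hT m).2
  have hbdd : BddBelow (Set.range fun m => ((ρ.M (Nm m) * T m).trace).re) :=
    ⟨0, Set.forall_mem_range.2 hnonneg⟩
  refine ((Real.iInf_nonneg hnonneg).eq_or_lt).elim Eq.symm fun hδ => ?_
  set δ := ⨅ m, ((ρ.M (Nm m) * T m).trace).re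
  have hlog : 0 < Real.log 2 := Real.log_pos one_lt_two
  set L := (c + 1) * Real.log 2 / δ with hL
  have hL0 : 0 ≤ L := by positivity
  obtain ⟨m, hm⟩ := (hlim.eventually_lt_const (Real.exp_pos (-L))).exists
  obtain ⟨n, hn, hent⟩ := hc (Nm m)
  have hle := ρ.entropy_mul_log_two_le hn (hT m).1 (hT m).2 hm.le
  have hmass : (c + 1) * Real.log 2 ≤ ((ρ.M (Nm m) * T m).trace).re * L :=
    calc (c + 1) * Real.log 2 = δ * L := by rw [hL]; field_simp
      _ ≤ _ := mul_le_mul_of_nonneg_right (ciInf_le hbdd m) hL0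
  nlinarith [mul_lt_mul_of_pos_right hent hlog]
end

section
/- If a state ρ = (ρ_n)_{n≥1} is strong quantum random, then ρ passes every test given by a sequence of projections with summable normalized traces: for every sequence (G^m)_{m≥1} of Hermitian projections, with G^m on ℂ^{2^{N_m}}, such that ∑_{m≥1} 2^{-N_m}·Tr(G^m) < ∞, and for every δ > 0, there are only finitely many m with Tr(ρ_{N_m}·G^m) > δ. -/
open Matrix Filter MeasureTheory
open scoped ComplexOrder

/-- If a state `ρ` is strong quantum random (it satisfies every
quantum null condition), then it passes every test given by a sequence of Hermitian
projections with summable normalized traces: for every `δ > 0` only finitely many `m`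
satisfy `Tr(ρ_(N_m)·G^m) > δ`. -/
theorem strong_quantum_random_passes_summable_tests (ρ : QState)
    (hsqr : ∀ (Nm : ℕ → ℕ)
      (T : (m : ℕ) → Matrix (Fin (Nm m) → Bool) (Fin (Nm m) → Bool) ℂ),
      (∀ m, (T m).IsHermitian ∧ T m * T m = T m) →
      Filter.Tendsto (fun m => (2 : ℝ) ^ (-(Nm m : ℤ)) * ((T m).trace).re)
        Filter.atTop (nhds 0) →
      ⨅ m, ((ρ.M (Nm m) * T m).trace).re = 0) :
    ∀ (Nm : ℕ → ℕ)
      (G : (m : ℕ) → Matrix (Fin (Nm m) → Bool) (Fin (Nm m) → Bool) ℂ),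
      (∀ m, (G m).IsHermitian ∧ G m * G m = G m) →
      Summable (fun m => (2 : ℝ) ^ (-(Nm m : ℤ)) * ((G m).trace).re) →
      ∀ δ > (0 : ℝ), {m : ℕ | δ < ((ρ.M (Nm m) * G m).trace).re}.Finite := by
  intro Nm G hG hsum δ hδ
  by_contra hinf
  -- Along the infinitely many failures the normalized traces still tend to zero.
  have hfreq : ∃ᶠ m in Filter.atTop, δ < ((ρ.M (Nm m) * G m).trace).re :=
    Nat.frequently_atTop_iff_infinite.mpr hinf
  obtain ⟨φ, hφ, hlarge⟩ := Filter.extraction_of_frequently_atTop hfreq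
  have hzero := hsqr (fun k => Nm (φ k)) (fun k => G (φ k)) (fun k => hG (φ k))
    (hsum.tendsto_atTop_zero.comp hφ.tendsto_atTop)
  have hle : δ ≤ ⨅ k, ((ρ.M (Nm (φ k)) * G (φ k)).trace).re :=
    le_ciInf fun k => (hlarge k).le
  exact absurd (hle.trans_eq hzero) (not_le.mpr hδ)
end

section
/- Let f : (0,1) → ℝ be nonnegative and Lebesgue integrable with ∫₀¹ f(x) dx = 1. For each n and each length-n bitstring σ let α_σ = ∫_{[σ]} f(x) dx, and let ρ = (ρ_n)_{n≥1} be the diagonal state with ρ_n = ∑_{σ ∈ 2^n} α_σ|σ⟩⟨σ|. Then ρ is strong quantum random: for every sequence (G^t)_{t≥1} of Hermitian projections, with G^t on ℂ^{2^{N_t}}, satisfying lim_{t→∞} 2^{-N_t}·Tr(G^t) = 0, one has inf_t Tr(ρ_{N_t}·G^t) = 0. -/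
open Matrix MeasureTheory

/-- The left endpoint of the dyadic interval `[σ]` determined by the bitstring `σ`. -/
noncomputable def dyadicLeft {n : ℕ} (σ : Fin n → Bool) : ℝ :=
  ∑ i : Fin n, if σ i then (2 : ℝ) ^ (-(i : ℤ) - 1) else 0

/-- The dyadic interval `[σ] ⊆ [0,1)` of length `2^(-n)`. -/
noncomputable def dyadicInterval {n : ℕ} (σ : Fin n → Bool) : Set ℝ :=
  Set.Ico (dyadicLeft σ) (dyadicLeft σ + (2 : ℝ) ^ (-(n : ℤ)))

lemma dyadicLeft_snoc {n : ℕ} (σ : Fin n → Bool) (b : Bool) :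
    dyadicLeft (Fin.snoc σ b : Fin (n + 1) → Bool) =
      dyadicLeft σ + if b then (2 : ℝ) ^ (-((n + 1 : ℕ) : ℤ)) else 0 := by
  unfold dyadicLeft
  rw [Fin.sum_univ_castSucc]
  simp only [Fin.snoc_castSucc, Fin.snoc_last, Fin.val_castSucc, Fin.val_last]
  congr 2
  push_cast
  ring_nf

lemma two_zpow_neg_succ (n : ℕ) :
    (2 : ℝ) ^ (-(n : ℤ)) = 2 ^ (-((n + 1 : ℕ) : ℤ)) + 2 ^ (-((n + 1 : ℕ) : ℤ)) := by
  rw [← two_mul, ← zpow_one_add₀ two_ne_zero]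
  congr 1
  push_cast
  ring

lemma dyadicLeft_bounds {n : ℕ} (σ : Fin n → Bool) :
    0 ≤ dyadicLeft σ ∧ dyadicLeft σ + (2 : ℝ) ^ (-(n : ℤ)) ≤ 1 := by
  induction n with
  | zero => simp [dyadicLeft]
  | succ n ih =>
    rw [← Fin.snoc_init_self σ, dyadicLeft_snoc]
    obtain ⟨h0, h1⟩ := ih (Fin.init σ)
    rw [two_zpow_neg_succ] at h1
    have hw : (0 : ℝ) < 2 ^ (-((n + 1 : ℕ) : ℤ)) := by positivity
    split_ifs <;> constructor <;> linarith

lemma dyadicInterval_subset {n : ℕ} (σ : Fin n → Bool) :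
    dyadicInterval σ ⊆ Set.Ico 0 1 :=
  Set.Ico_subset_Ico (dyadicLeft_bounds σ).1 (dyadicLeft_bounds σ).2

lemma setIntegral_dyadicInterval_eq_intervalIntegral {n : ℕ} (g : ℝ → ℝ) (σ : Fin n → Bool) :
    ∫ x in dyadicInterval σ, g x =
      ∫ x in dyadicLeft σ..(dyadicLeft σ + (2 : ℝ) ^ (-(n : ℤ))), g x := by
  rw [intervalIntegral.integral_of_le (le_add_of_nonneg_right (by positivity)),
    integral_Ioc_eq_integral_Ioo, dyadicInterval, integral_Ico_eq_integral_Ioo]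

/-- Each dyadic interval splits into its two halves. -/
lemma setIntegral_dyadicInterval_split {n : ℕ} {g : ℝ → ℝ} (hg : Integrable g)
    (σ : Fin n → Bool) :
    ∫ x in dyadicInterval σ, g x =
      ∑ b, ∫ x in dyadicInterval (Fin.snoc σ b : Fin (n + 1) → Bool), g x := by
  simp only [setIntegral_dyadicInterval_eq_intervalIntegral, dyadicLeft_snoc, Fintype.sum_bool,
    if_true, Bool.false_eq_true, if_false, add_zero]
  rw [add_comm (∫ _ in _.._, _), intervalIntegral.integral_add_adjacent_intervals hg.intervalIntegrable
    hg.intervalIntegrable, two_zpow_neg_succ, add_assoc]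

lemma sum_setIntegral_dyadicInterval {g : ℝ → ℝ} (hg : Integrable g) (n : ℕ) :
    ∑ σ : Fin n → Bool, ∫ x in dyadicInterval σ, g x = ∫ x in Set.Ico (0 : ℝ) 1, g x := by
  induction n with
  | zero => simp [dyadicInterval, dyadicLeft]
  | succ n ih =>
    rw [← ih, ← (Fin.snocEquiv fun _ : Fin (n + 1) => Bool).sum_comp, Fintype.sum_prod_type_right]
    refine Finset.sum_congr rfl fun σ _ => ?_
    rw [setIntegral_dyadicInterval_split hg]
    rfl

lemma setIntegral_dyadicInterval_indicator {n : ℕ} (f : ℝ → ℝ) (σ : Fin n → Bool) :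
    ∫ x in dyadicInterval σ, (Set.Ioo (0 : ℝ) 1).indicator f x =
      ∫ x in dyadicInterval σ, f x := by
  refine setIntegral_congr_ae measurableSet_Ico ?_
  filter_upwards [Measure.ae_ne volume (0 : ℝ)] with x hx0 hx
  have hx' := dyadicInterval_subset σ hx
  have hmem : x ∈ Set.Ioo (0 : ℝ) 1 := ⟨lt_of_le_of_ne hx'.1 hx0.symm, hx'.2⟩
  exact Set.indicator_of_mem hmem f

lemma integrable_max_sub_natCast {F : ℝ → ℝ} (hF : Integrable F) (h0 : ∀ x, 0 ≤ F x) (M : ℕ) :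
    Integrable fun x => max (F x - M) 0 := by
  refine hF.mono ((hF.aestronglyMeasurable.sub aestronglyMeasurable_const).sup
    aestronglyMeasurable_const) (.of_forall fun x => ?_)
  rw [Real.norm_of_nonneg (le_max_right _ _), Real.norm_of_nonneg (h0 x)]
  exact max_le (sub_le_self _ M.cast_nonneg) (h0 x)

lemma tendsto_integral_max_sub_natCast {F : ℝ → ℝ} (hF : Integrable F) (h0 : ∀ x, 0 ≤ F x) :
    Filter.Tendsto (fun M : ℕ => ∫ x, max (F x - M) 0) Filter.atTop (nhds 0) := by
  suffices h : Filter.Tendsto (fun M : ℕ => ∫ x, max (F x - M) 0) Filter.atTop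
      (nhds (∫ _ : ℝ, (0 : ℝ))) by
    rwa [integral_zero] at h
  refine tendsto_integral_of_dominated_convergence F
    (fun M => (integrable_max_sub_natCast hF h0 M).aestronglyMeasurable) hF
    (fun M => .of_forall fun x => ?_) (.of_forall fun x => ?_)
  · rw [Real.norm_of_nonneg (le_max_right _ _)]
    exact max_le (sub_le_self _ M.cast_nonneg) (h0 x)
  · refine tendsto_const_nhds.congr' ?_
    filter_upwards [Filter.eventually_ge_atTop ⌈F x⌉₊] with M hM
    exact (max_eq_right (sub_nonpos.2 (Nat.ceil_le.1 hM))).symm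

lemma setIntegral_dyadicInterval_le {F : ℝ → ℝ} (hF : Integrable F) (h0 : ∀ x, 0 ≤ F x)
    (M : ℕ) {n : ℕ} (σ : Fin n → Bool) :
    ∫ x in dyadicInterval σ, F x ≤
      M * (2 : ℝ) ^ (-(n : ℤ)) + ∫ x in dyadicInterval σ, max (F x - M) 0 := by
  have hc : IntegrableOn (fun _ : ℝ => (M : ℝ)) (dyadicInterval σ) :=
    integrableOn_const (by simp [dyadicInterval])
  have hh := (integrable_max_sub_natCast hF h0 M).integrableOn (s := dyadicInterval σ)
  have hconst : ∫ _ in dyadicInterval σ, (M : ℝ) = M * (2 : ℝ) ^ (-(n : ℤ)) := by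
    rw [setIntegral_dyadicInterval_eq_intervalIntegral, intervalIntegral.integral_const,
      smul_eq_mul]
    ring
  rw [← hconst, ← integral_add hc hh]
  refine integral_mono hF.integrableOn (hc.add hh) fun x => ?_
  have := le_max_left (F x - M) 0
  simp only
  linarith

/-- Diagonal entries of a Hermitian projection lie in `[0, 1]`. -/
lemma Matrix.IsHermitian.re_diag_mem_Icc_of_mul_self {ι : Type*} [Fintype ι] {G : Matrix ι ι ℂ}
    (hG : G.IsHermitian) (hGG : G * G = G) (i : ι) : (G i i).re ∈ Set.Icc (0 : ℝ) 1 := by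
  have h : (G i i).re = ∑ j, Complex.normSq (G i j) := by
    conv_lhs => rw [← hGG, Matrix.mul_apply, Complex.re_sum]
    refine Finset.sum_congr rfl fun j _ => ?_
    rw [← hG.apply j i, Complex.star_def, Complex.mul_conj, Complex.ofReal_re]
  have hle : Complex.normSq (G i i) ≤ (G i i).re := by
    conv_rhs => rw [h]
    exact Finset.single_le_sum (f := fun j => Complex.normSq (G i j))
      (fun j _ => Complex.normSq_nonneg _) (Finset.mem_univ i)
  rw [Complex.normSq_apply] at hle
  constructor <;> nlinarith [mul_self_nonneg (G i i).re, mul_self_nonneg (G i i).im]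

lemma re_trace_diagonal_ofReal_mul {ι : Type*} [Fintype ι] [DecidableEq ι] (a : ι → ℝ)
    (G : Matrix ι ι ℂ) :
    (Matrix.diagonal (fun i => (a i : ℂ)) * G).trace.re = ∑ i, a i * (G i i).re := by
  simp [Matrix.trace, Matrix.diagonal_mul]

/-- Truncating the density at height `M` bounds the weighted sum of its cell masses. -/
lemma sum_setIntegral_dyadicInterval_mul_le {F : ℝ → ℝ} (hF : Integrable F) (h0 : ∀ x, 0 ≤ F x)
    (M : ℕ) {n : ℕ} {w : (Fin n → Bool) → ℝ} (hw : ∀ σ, w σ ∈ Set.Icc (0 : ℝ) 1) :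
    ∑ σ, (∫ x in dyadicInterval σ, F x) * w σ ≤
      M * ((2 : ℝ) ^ (-(n : ℤ)) * ∑ σ, w σ) + ∫ x, max (F x - M) 0 := by
  have hh := integrable_max_sub_natCast hF h0 M
  have hnn : ∀ x, 0 ≤ max (F x - M) 0 := fun x => le_max_right _ _
  calc ∑ σ, (∫ x in dyadicInterval σ, F x) * w σ
      ≤ ∑ σ, (M * (2 : ℝ) ^ (-(n : ℤ)) * w σ + ∫ x in dyadicInterval σ, max (F x - M) 0) := by
        refine Finset.sum_le_sum fun σ _ => ?_
        have h1 := mul_le_mul_of_nonneg_right (setIntegral_dyadicInterval_le hF h0 M σ) (hw σ).1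
        have h2 := mul_le_of_le_one_right
          (integral_nonneg (μ := volume.restrict (dyadicInterval σ)) hnn) (hw σ).2
        rw [add_mul] at h1
        exact h1.trans (add_le_add_right h2 _)
    _ = M * ((2 : ℝ) ^ (-(n : ℤ)) * ∑ σ, w σ) + ∫ x in Set.Ico (0 : ℝ) 1, max (F x - M) 0 := by
        rw [Finset.sum_add_distrib, sum_setIntegral_dyadicInterval hh, ← Finset.mul_sum, mul_assoc]
    _ ≤ _ := add_le_add_right (setIntegral_le_integral hh (.of_forall hnn)) _

/-- Let `f` be nonnegative and integrable on `(0,1)` with `∫₀¹ f = 1`,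
and let `ρ` be the induced diagonal state, `ρ_n = diagonal (σ ↦ ∫_[σ] f)`.  Then `ρ` is
strong quantum random: for every sequence of Hermitian projections `G^t` on
`ℂ^(2^(N_t))` with `lim_t 2^(-N_t)·Tr(G^t) = 0`, one has `inf_t Tr(ρ_(N_t)·G^t) = 0`. -/
theorem diagonal_state_strong_quantum_random (f : ℝ → ℝ)
    (hpos : ∀ x ∈ Set.Ioo (0 : ℝ) 1, 0 ≤ f x)
    (hint : IntegrableOn f (Set.Ioo 0 1))
    (hone : ∫ x in Set.Ioo (0 : ℝ) 1, f x = 1) :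
    ∀ (Nt : ℕ → ℕ) (G : (t : ℕ) → Matrix (Fin (Nt t) → Bool) (Fin (Nt t) → Bool) ℂ),
      (∀ t, (G t).IsHermitian ∧ G t * G t = G t) →
      Filter.Tendsto (fun t => (2 : ℝ) ^ (-(Nt t : ℤ)) * ((G t).trace).re)
        Filter.atTop (nhds 0) →
      ⨅ t, ((Matrix.diagonal (fun σ : Fin (Nt t) → Bool =>
          ((∫ x in dyadicInterval σ, f x : ℝ) : ℂ)) * G t).trace).re = 0 := by
  intro Nt G hG hlim
  set F : ℝ → ℝ := (Set.Ioo (0 : ℝ) 1).indicator f with hFdef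
  have hF : Integrable F := hint.integrable_indicator measurableSet_Ioo
  have h0 : ∀ x, 0 ≤ F x := Set.indicator_nonneg hpos
  have hw (t) := (hG t).1.re_diag_mem_Icc_of_mul_self (hG t).2
  simp only [re_trace_diagonal_ofReal_mul, ← setIntegral_dyadicInterval_indicator f, ← hFdef]
  simp only [Matrix.trace, Matrix.diag_apply, Complex.re_sum] at hlim
  have hnonneg (t : ℕ) : 0 ≤ ∑ σ, (∫ x in dyadicInterval σ, F x) * (G t σ σ).re :=
    Finset.sum_nonneg fun σ _ => mul_nonneg (integral_nonneg h0) (hw t σ).1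
  refine le_antisymm (ge_of_tendsto' (tendsto_integral_max_sub_natCast hF h0) fun M => ?_)
    (Real.iInf_nonneg hnonneg)
  have hbound := (hlim.const_mul (M : ℝ)).add_const (∫ x, max (F x - M) 0)
  rw [mul_zero, zero_add] at hbound
  exact ge_of_tendsto' hbound fun t =>
    (ciInf_le ⟨0, Set.forall_mem_range.2 hnonneg⟩ t).trans
      (sum_setIntegral_dyadicInterval_mul_le hF h0 M (hw t))
end

section
/- Let ρ = (ρ_n)_{n≥1} be a state. For each n let α^n_1 ≥ α^n_2 ≥ … ≥ α^n_{2^n} be the eigenvalues of ρ_n listed in non-increasing order, and let f^ρ_n : [0,1) → ℝ be the step function with f^ρ_n(x) = 2^n·α^n_i for x ∈ [(i-1)·2^{-n}, i·2^{-n}). Suppose the family (f^ρ_n)_{n≥1} is uniformly integrable: for every δ > 0 there exists ε > 0 such that for every Lebesgue-measurable S ⊆ [0,1) with μ(S) ≤ ε and every n, ∫_S f^ρ_n dμ < δ. Then ρ is strong quantum random: for every sequence (T^m)_{m≥1} of Hermitian projections, with T^m on ℂ^{2^{N_m}}, satisfying lim_{m→∞} 2^{-N_m}·Tr(T^m) =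 0, one has inf_m Tr(ρ_{N_m}·T^m) = 0. -/
open Matrix Filter MeasureTheory
open scoped ComplexOrder

/-- A function equal to the constants `c i` on consecutive intervals of length `h` is integrable on
the first `k` of them, and its integral is the corresponding finite sum. -/
theorem integrableOn_and_setIntegral_step {g : ℝ → ℝ} {h : ℝ} (hh : 0 ≤ h) {c : ℕ → ℝ} (k : ℕ)
    (hg : ∀ i < k, ∀ x ∈ Set.Ico ((i : ℝ) * h) (((i : ℝ) + 1) * h), g x = c i) :
    IntegrableOn g (Set.Ico 0 (k * h)) ∧
      ∫ x in Set.Ico 0 (k * h), g x = h * ∑ i ∈ Finset.range k, c i := by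
  induction k with
  | zero => simp
  | succ k ih =>
    obtain ⟨hint, hval⟩ := ih fun i hi => hg i (hi.trans k.lt_succ_self)
    have hk := hg k k.lt_succ_self
    have hle : (k : ℝ) * h ≤ (k + 1) * h := by nlinarith
    have hunion : Set.Ico (0 : ℝ) ((k + 1 : ℕ) * h) =
        Set.Ico 0 (k * h) ∪ Set.Ico (k * h) ((k + 1) * h) := by
      push_cast
      exact (Set.Ico_union_Ico_eq_Ico (by positivity) hle).symm
    have hlast : IntegrableOn g (Set.Ico (k * h) ((k + 1) * h)) :=
      (integrableOn_const (C := c k) (by simp)).congr_fun (fun x hx => (hk x hx).symm)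
        measurableSet_Ico
    rw [hunion]
    refine ⟨hint.union hlast, ?_⟩
    rw [setIntegral_union (Set.Ico_disjoint_Ico_same) measurableSet_Ico hint hlast, hval,
      setIntegral_congr_fun measurableSet_Ico hk, setIntegral_const, Finset.sum_range_succ,
      Real.volume_real_Ico_of_le hle, smul_eq_mul]
    ring

/-- Weights in `[0, 1]` of total mass `k` cannot pick up more from a nonnegative non-increasing
finite sequence than its first `k` terms. -/
theorem sum_mul_le_sum_of_antitone {N k : ℕ} {a t : Fin N → ℝ} (ha : Antitone a)
    (ha0 : ∀ i, 0 ≤ a i) (ht0 : ∀ i, 0 ≤ t i) (ht1 : ∀ i, t i ≤ 1) (hk : k ≤ N)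
    (hsum : ∑ i, t i = k) :
    ∑ i, a i * t i ≤ ∑ i : Fin N, if (i : ℕ) < k then a i else 0 := by
  obtain ⟨c, hc, hc'⟩ : ∃ c, (∀ i : Fin N, (i : ℕ) < k → c ≤ a i) ∧
      ∀ i : Fin N, k ≤ (i : ℕ) → a i ≤ c := by
    rcases hk.lt_or_eq with hlt | rfl
    · exact ⟨a ⟨k, hlt⟩, fun i hi => ha (Fin.le_def.2 hi.le), fun i hi => ha (Fin.le_def.2 hi)⟩
    · exact ⟨0, fun i _ => ha0 i, fun i hi => absurd i.2 hi.not_gt⟩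
  have hcard : ∑ i : Fin N, (if (i : ℕ) < k then (1 : ℝ) else 0) = k := by
    rw [Fin.sum_univ_eq_sum_range (fun i => if i < k then (1 : ℝ) else 0), ← Finset.sum_filter,
      show (Finset.range N).filter (· < k) = Finset.range k by ext; simp; omega]
    simp
  have hterm : ∀ i : Fin N, a i * t i - (if (i : ℕ) < k then a i else 0) ≤
      c * (t i - if (i : ℕ) < k then 1 else 0) := by
    intro i
    split_ifs with hi
    · nlinarith [hc i hi, ht1 i]
    · nlinarith [hc' i (not_lt.1 hi), ht0 i]
  have htotal := Finset.sum_le_sum fun i (_ : i ∈ Finset.univ) => hterm i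
  rw [← Finset.mul_sum, Finset.sum_sub_distrib, Finset.sum_sub_distrib, hsum, hcard] at htotal
  linarith

namespace Matrix

variable {ι : Type*} [Fintype ι]

/-- The diagonal entries of a Hermitian projection lie in `[0, 1]`. -/
theorem IsHermitian.re_apply_self_mem_Icc_of_mul_self {P : Matrix ι ι ℂ} (hP : P.IsHermitian)
    (hPP : P * P = P) (i : ι) : (P i i).re ∈ Set.Icc (0 : ℝ) 1 := by
  have hentry : (P i i).re = ∑ j, Complex.normSq (P i j) := by
    conv_lhs => rw [← hPP, mul_apply, Complex.re_sum]
    refine Finset.sum_congr rfl fun j _ => ?_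
    rw [← hP.apply j i, Complex.star_def, Complex.mul_conj, Complex.ofReal_re]
  have hle : Complex.normSq (P i i) ≤ (P i i).re := by
    conv_rhs => rw [hentry]
    exact Finset.single_le_sum (fun j _ => Complex.normSq_nonneg (P i j)) (Finset.mem_univ i)
  rw [Complex.normSq_apply] at hle
  constructor <;> nlinarith [mul_self_nonneg (P i i).re, mul_self_nonneg (P i i).im]

/-- The trace of an idempotent matrix is its rank. -/
theorem trace_eq_rank_of_mul_self [DecidableEq ι] {P : Matrix ι ι ℂ} (hPP : P * P = P) :
    P.trace = P.rank := by
  have hid : IsIdempotentElem P.toLin' := by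
    rw [IsIdempotentElem, Module.End.mul_eq_comp, ← toLin'_mul, hPP]
  rw [← trace_toLin'_eq, (LinearMap.IsIdempotentElem.isProj_range _ hid).trace]
  rfl

/-- Pairing a Hermitian matrix with a Hermitian projection averages the eigenvalues with weights
in `[0, 1]` whose sum is the rank of the projection. -/
theorem IsHermitian.exists_weights_trace_mul [DecidableEq ι] {A P : Matrix ι ι ℂ}
    (hA : A.IsHermitian) (hP : P.IsHermitian) (hPP : P * P = P) :
    ∃ t : ι → ℝ, (∀ i, t i ∈ Set.Icc (0 : ℝ) 1) ∧ ∑ i, t i = P.rank ∧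
      (A * P).trace.re = ∑ i, hA.eigenvalues i * t i := by
  let U : Matrix ι ι ℂ := ↑hA.eigenvectorUnitary
  have hUU : U * star U = 1 := Unitary.coe_mul_star_self _
  have hQ : (star U * P * U).IsHermitian := by
    simpa [star_eq_conjTranspose] using isHermitian_conjTranspose_mul_mul U hP
  have hQQ : star U * P * U * (star U * P * U) = star U * P * U := by
    calc star U * P * U * (star U * P * U) = star U * P * (U * star U) * P * U := by
          simp only [mul_assoc]
      _ = star U * (P * P) * U := by rw [hUU, mul_one]; simp only [mul_assoc]
      _ = _ := by rw [hPP]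
  refine ⟨fun i => ((star U * P * U) i i).re, hQ.re_apply_self_mem_Icc_of_mul_self hQQ, ?_, ?_⟩
  · have htr : (star U * P * U).trace = P.rank := by
      rw [trace_mul_comm, ← mul_assoc, hUU, one_mul, trace_eq_rank_of_mul_self hPP]
    simpa [trace] using congrArg Complex.re htr
  · have hspec : A = U * diagonal (RCLike.ofReal ∘ hA.eigenvalues) * star U :=
      hA.spectral_theorem
    have htr : (A * P).trace =
        (diagonal (RCLike.ofReal ∘ hA.eigenvalues) * (star U * P * U)).trace := by
      conv_lhs => rw [hspec]
      rw [mul_assoc, mul_assoc, trace_mul_comm]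
      simp only [mul_assoc]
    rw [htr]
    simp [trace, diagonal_mul]

end Matrix

/-- Let `ρ` be a state, `α n` the eigenvalues of `ρ_n` in
non-increasing order, and `f n` the step function on `[0,1)` taking the value
`2^n·(α n i)` on `[(i)·2^(-n), (i+1)·2^(-n))` (0-indexed).  If the family `(f n)` is
uniformly integrable, then `ρ` is strong quantum random: for every sequence of
Hermitian projections `T^m` on `ℂ^(2^(N_m))` with `lim_m 2^(-N_m)·Tr(T^m) = 0`, one has
`inf_m Tr(ρ_(N_m)·T^m) = 0`. -/
theorem uniformly_integrable_implies_strong_quantum_random (ρ : QState)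
    (α : (n : ℕ) → Fin (2 ^ n) → ℝ)
    (hα : ∀ n, Antitone (α n))
    (hperm : ∀ n, ∃ e : (Fin n → Bool) ≃ Fin (2 ^ n),
      ∀ i, α n (e i) = (ρ.posSemidef n).1.eigenvalues i)
    (f : ℕ → ℝ → ℝ)
    (hstep : ∀ (n : ℕ) (i : Fin (2 ^ n)), ∀ x ∈ Set.Ico
        ((i : ℝ) * (2 : ℝ) ^ (-(n : ℤ))) (((i : ℝ) + 1) * (2 : ℝ) ^ (-(n : ℤ))),
      f n x = 2 ^ n * α n i)
    (hui : ∀ δ > (0 : ℝ), ∃ ε > (0 : ℝ), ∀ S : Set ℝ, MeasurableSet S →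
      S ⊆ Set.Ico (0 : ℝ) 1 → volume S ≤ ENNReal.ofReal ε →
      ∀ n, (∫ x in S, f n x) < δ) :
    ∀ (Nm : ℕ → ℕ) (T : (m : ℕ) → Matrix (Fin (Nm m) → Bool) (Fin (Nm m) → Bool) ℂ),
      (∀ m, (T m).IsHermitian ∧ T m * T m = T m) →
      Filter.Tendsto (fun m => (2 : ℝ) ^ (-(Nm m : ℤ)) * ((T m).trace).re)
        Filter.atTop (nhds 0) →
      ⨅ m, ((ρ.M (Nm m) * T m).trace).re = 0 := by
  intro Nm T hT hlim
  have hbound : ∀ m, 0 ≤ ((ρ.M (Nm m) * T m).trace).re ∧ ((ρ.M (Nm m) * T m).trace).re ≤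
      ∫ x in Set.Ico 0 ((T m).rank * (2 : ℝ) ^ (-(Nm m : ℤ))), f (Nm m) x := by
    intro m
    obtain ⟨t, ht, hsum, htr⟩ :=
      (ρ.posSemidef (Nm m)).1.exists_weights_trace_mul (hT m).1 (hT m).2
    obtain ⟨e, he⟩ := hperm (Nm m)
    have hev : ∀ i, 0 ≤ (ρ.posSemidef (Nm m)).1.eigenvalues i :=
      (ρ.posSemidef (Nm m)).eigenvalues_nonneg
    refine ⟨htr ▸ Finset.sum_nonneg fun i _ => mul_nonneg (hev i) (ht i).1, ?_⟩
    have hrank : (T m).rank ≤ 2 ^ Nm m := by simpa using (T m).rank_le_card_width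
    have hα0 : ∀ i, 0 ≤ α (Nm m) i := fun i => by
      simpa [← he] using hev (e.symm i)
    have hmain := sum_mul_le_sum_of_antitone (t := t ∘ e.symm) (hα (Nm m)) hα0
      (fun i => (ht _).1) (fun i => (ht _).2) hrank
      (by rw [← hsum]; exact e.symm.sum_comp t)
    have hreindex : ((ρ.M (Nm m) * T m).trace).re = ∑ i, α (Nm m) i * (t ∘ e.symm) i := by
      rw [htr, ← e.sum_comp]
      simp [he]
    let c : ℕ → ℝ := fun i => if hi : i < 2 ^ Nm m then 2 ^ Nm m * α (Nm m) ⟨i, hi⟩ else 0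
    have hint := (integrableOn_and_setIntegral_step (g := f (Nm m)) (c := c)
      (h := (2 : ℝ) ^ (-(Nm m : ℤ))) (by positivity) (T m).rank fun i hi x hx => by
        have hi' := hi.trans_le hrank
        simpa [c, hi'] using hstep (Nm m) ⟨i, hi'⟩ x hx).2
    rw [hint, hreindex]
    refine hmain.trans_eq ?_
    have hsumc : ∑ i ∈ Finset.range (T m).rank, c i =
        ∑ i : Fin (2 ^ Nm m), if (i : ℕ) < (T m).rank then c i else 0 := by
      rw [Fin.sum_univ_eq_sum_range (fun i => if i < (T m).rank then c i else 0),
        ← Finset.sum_filter]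
      congr 1
      ext i
      simp
      omega
    rw [hsumc, Finset.mul_sum]
    refine Finset.sum_congr rfl fun i _ => ?_
    split_ifs
    · simp [c]
    · simp
  have hbdd : BddBelow (Set.range fun m => ((ρ.M (Nm m) * T m).trace).re) :=
    ⟨0, by rintro _ ⟨m, rfl⟩; exact (hbound m).1⟩
  refine le_antisymm (le_of_forall_pos_le_add fun δ hδ => ?_) (le_ciInf fun m => (hbound m).1)
  obtain ⟨ε, hε, hS⟩ := hui δ hδ
  obtain ⟨m, hm⟩ := (hlim.eventually_lt_const (lt_min hε one_pos)).exists
  rw [trace_eq_rank_of_mul_self (hT m).2, Complex.natCast_re, mul_comm] at hm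
  have hlt := hS _ measurableSet_Ico
    (Set.Ico_subset_Ico_right (hm.le.trans (min_le_right _ _)))
    (by rw [Real.volume_Ico, sub_zero]
        exact ENNReal.ofReal_le_ofReal (hm.le.trans (min_le_left _ _))) (Nm m)
  rw [zero_add]
  exact (ciInf_le hbdd m).trans ((hbound m).2.trans hlt.le)
end
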